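/- Confluence (Church-Rosser property) of φ-calculus: for φ-terms t, u, v, if t ⇝* u and t ⇝* v (where ⇝* is the reflexive-transitive closure of one-step reduction ⇝) then there exists a φ-term w such that u ⇝* w and v ⇝* w. -/

import Mathlib

namespace PhiCalc

/-- φ-terms over a set of attribute labels `L`. An object term carries a finite
list of attributes: `(a, none)` is a void attribute, `(b, some t)` is an
attached attribute. -/
inductive Tm (L : Type) : Type where
  | loc : Nat → Tm L
  | dot : Tm L → L → Tm L
  | app : Tm L → L → Tm L → Tm L
  | obj : List (L × Option (Tm L)) → Tm L

namespace Tm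

variable {L : Type}

/-- Look up a label among the attributes of an object:
`none` = the label is missing, `some none` = void attribute,
`some (some t)` = attribute attached to `t`. -/
def lookupAttr [DecidableEq L] (a : L) : List (L × Option (Tm L)) → Option (Option (Tm L))
  | [] => none
  | (b, o) :: rest => if a = b then some o else lookupAttr a rest

/-- Attach term `u` to the (first occurrence of) label `a`. -/
def attachAttr [DecidableEq L] (a : L) (u : Tm L) :
    List (L × Option (Tm L)) → List (L × Option (Tm L))
  | [] => []
  | (b, o) :: rest => if a = b then (b, some u) :: rest else (b, o) :: attachAttr a u rest

mutual
/-- Locator increment `↑ₙ t`. -/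
def incAt : Nat → Tm L → Tm L
  | n, loc m => if m < n then loc m else loc (m + 1)
  | n, dot t a => dot (incAt n t) a
  | n, app t a u => app (incAt n t) a (incAt n u)
  | n, obj attrs => obj (incAtList (n + 1) attrs)

def incAtList : Nat → List (L × Option (Tm L)) → List (L × Option (Tm L))
  | _, [] => []
  | n, (a, none) :: rest => (a, none) :: incAtList n rest
  | n, (a, some t) :: rest => (a, some (incAt n t)) :: incAtList n rest
end

mutual
/-- Locator substitution `t[ρ^n ↦ u]`. -/
def subst : Tm L → Nat → Tm L → Tm L
  | loc m, n, u => if m < n then loc m else if m = n then u else loc (m - 1)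
  | dot t a, n, u => dot (subst t n u) a
  | app t a v, n, u => app (subst t n u) a (subst v n u)
  | obj attrs, n, u => obj (substList attrs (n + 1) (incAt 0 u))

def substList : List (L × Option (Tm L)) → Nat → Tm L → List (L × Option (Tm L))
  | [], _, _ => []
  | (a, none) :: rest, n, u => (a, none) :: substList rest n u
  | (a, some t) :: rest, n, u => (a, some (subst t n u)) :: substList rest n u
end

section Reductions

variable [DecidableEq L]

/-- One-step (regular) reduction `⇝`, parametrized by the decorator label `phi`. -/
inductive Step (phi : L) : Tm L → Tm L → Prop where
  | congObj {t t' : Tm L} (pre post : List (L × Option (Tm L))) (b : L) :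
      Step phi t t' →
      Step phi (obj (pre ++ (b, some t) :: post)) (obj (pre ++ (b, some t') :: post))
  | congDot {t t' : Tm L} (a : L) : Step phi t t' → Step phi (dot t a) (dot t' a)
  | congAppL {t t' u : Tm L} (a : L) : Step phi t t' → Step phi (app t a u) (app t' a u)
  | congAppR {t u u' : Tm L} (a : L) : Step phi u u' → Step phi (app t a u) (app t a u')
  | dotStep {attrs : List (L × Option (Tm L))} {c : L} {tc : Tm L} :
      lookupAttr c attrs = some (some tc) →
      Step phi (dot (obj attrs) c) (subst tc 0 (obj attrs))
  | dotPhi {attrs : List (L × Option (Tm L))} {c : L} :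
      lookupAttr c attrs = none → (lookupAttr phi attrs).isSome →
      Step phi (dot (obj attrs) c) (dot (dot (obj attrs) phi) c)
  | appStep {attrs : List (L × Option (Tm L))} {c : L} {u : Tm L} :
      lookupAttr c attrs = some none →
      Step phi (app (obj attrs) c u) (obj (attachAttr c (incAt 0 u) attrs))

mutual
/-- Parallel reduction `⇛`. -/
inductive Par (phi : L) : Tm L → Tm L → Prop where
  | loc (n : Nat) : Par phi (Tm.loc n) (Tm.loc n)
  | obj {attrs attrs' : List (L × Option (Tm L))} :
      ParAttrs phi attrs attrs' → Par phi (Tm.obj attrs) (Tm.obj attrs')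
  | congDot {t t' : Tm L} (a : L) : Par phi t t' → Par phi (Tm.dot t a) (Tm.dot t' a)
  | congApp {t t' u u' : Tm L} (a : L) :
      Par phi t t' → Par phi u u' → Par phi (Tm.app t a u) (Tm.app t' a u')
  | dotPar {t : Tm L} {attrs : List (L × Option (Tm L))} {c : L} {tc : Tm L} :
      Par phi t (Tm.obj attrs) → lookupAttr c attrs = some (some tc) →
      Par phi (Tm.dot t c) (subst tc 0 (Tm.obj attrs))
  | dotPhi {t : Tm L} {attrs : List (L × Option (Tm L))} {c : L} :
      Par phi t (Tm.obj attrs) → lookupAttr c attrs = none →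
      (lookupAttr phi attrs).isSome →
      Par phi (Tm.dot t c) (Tm.dot (Tm.dot (Tm.obj attrs) phi) c)
  | appPar {t : Tm L} {attrs : List (L × Option (Tm L))} {c : L} {u u' : Tm L} :
      Par phi t (Tm.obj attrs) → lookupAttr c attrs = some none → Par phi u u' →
      Par phi (Tm.app t c u) (Tm.obj (attachAttr c (incAt 0 u') attrs))

/-- Pointwise parallel reduction on attribute lists: void attributes are kept,
attached attributes reduce in parallel. -/
inductive ParAttrs (phi : L) :
    List (L × Option (Tm L)) → List (L × Option (Tm L)) → Prop where
  | nil : ParAttrs phi [] []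
  | void {rest rest' : List (L × Option (Tm L))} (a : L) :
      ParAttrs phi rest rest' → ParAttrs phi ((a, none) :: rest) ((a, none) :: rest')
  | attached {t t' : Tm L} {rest rest' : List (L × Option (Tm L))} (a : L) :
      Par phi t t' → ParAttrs phi rest rest' →
      ParAttrs phi ((a, some t) :: rest) ((a, some t') :: rest')
end

/-- Head reduction `→h`. -/
inductive Head (phi : L) : Tm L → Tm L → Prop where
  | dotStep {attrs : List (L × Option (Tm L))} {c : L} {tc : Tm L} :
      lookupAttr c attrs = some (some tc) →
      Head phi (dot (obj attrs) c) (subst tc 0 (obj attrs))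
  | dotPhi {attrs : List (L × Option (Tm L))} {c : L} :
      lookupAttr c attrs = none → (lookupAttr phi attrs).isSome →
      Head phi (dot (obj attrs) c) (dot (dot (obj attrs) phi) c)
  | appStep {attrs : List (L × Option (Tm L))} {c : L} {u : Tm L} :
      lookupAttr c attrs = some none →
      Head phi (app (obj attrs) c u) (obj (attachAttr c (incAt 0 u) attrs))
  | congDot {t t' : Tm L} (a : L) : Head phi t t' → Head phi (dot t a) (dot t' a)
  | congApp {t t' u : Tm L} (a : L) : Head phi t t' → Head phi (app t a u) (app t' a u)

/-- Internal parallel reduction `⇛ᵢ`. -/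
inductive ParI (phi : L) : Tm L → Tm L → Prop where
  | loc (n : Nat) : ParI phi (Tm.loc n) (Tm.loc n)
  | obj {attrs attrs' : List (L × Option (Tm L))} :
      ParAttrs phi attrs attrs' → ParI phi (Tm.obj attrs) (Tm.obj attrs')
  | congDot {t t' : Tm L} (a : L) : ParI phi t t' → ParI phi (Tm.dot t a) (Tm.dot t' a)
  | congApp {t t' u u' : Tm L} (a : L) :
      ParI phi t t' → Par phi u u' → ParI phi (Tm.app t a u) (Tm.app t' a u')

/-- Internal (regular) reduction `→ᵢ`. -/
inductive StepI (phi : L) : Tm L → Tm L → Prop where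
  | congObj {t t' : Tm L} (pre post : List (L × Option (Tm L))) (b : L) :
      Step phi t t' →
      StepI phi (obj (pre ++ (b, some t) :: post)) (obj (pre ++ (b, some t') :: post))
  | congDot {t t' : Tm L} (a : L) : StepI phi t t' → StepI phi (dot t a) (dot t' a)
  | congAppL {t t' u : Tm L} (a : L) : StepI phi t t' → StepI phi (app t a u) (app t' a u)
  | congAppR {t u u' : Tm L} (a : L) : Step phi u u' → StepI phi (app t a u) (app t a u')

end Reductions

end Tm

end PhiCalc
namespace PhiCalc
namespace Tm
section Extra
variable {L : Type} [DecidableEq L]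

mutual
/-- Complete development `t⁺`. -/
def cd (phi : L) : Tm L → Tm L
  | loc n => loc n
  | dot t a =>
    match cd phi t with
    | obj attrs =>
      match lookupAttr a attrs with
      | some (some ta) => subst ta 0 (obj attrs)
      | some none => dot (obj attrs) a
      | none =>
        if (lookupAttr phi attrs).isSome then dot (dot (obj attrs) phi) a
        else dot (obj attrs) a
    | t' => dot t' a
  | app t a u =>
    match cd phi t with
    | obj attrs =>
      match lookupAttr a attrs with
      | some none => obj (attachAttr a (incAt 0 (cd phi u)) attrs)
      | _ => app (obj attrs) a (cd phi u)
    | t' => app t' a (cd phi u)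
  | obj attrs => obj (cdList phi attrs)

def cdList (phi : L) : List (L × Option (Tm L)) → List (L × Option (Tm L))
  | [] => []
  | (a, none) :: rest => (a, none) :: cdList phi rest
  | (a, some t) :: rest => (a, some (cd phi t)) :: cdList phi rest
end

/-- Head reduction as a (deterministic) partial function. -/
def headRed (phi : L) : Tm L → Option (Tm L)
  | loc _ => none
  | obj _ => none
  | dot t a =>
    match t with
    | obj attrs =>
      match lookupAttr a attrs with
      | some (some ta) => some (subst ta 0 (obj attrs))
      | some none => none
      | none =>
        if (lookupAttr phi attrs).isSome then some (dot (dot (obj attrs) phi) a)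
        else none
    | t => (headRed phi t).map (fun t' => dot t' a)
  | app t a u =>
    match t with
    | obj attrs =>
      match lookupAttr a attrs with
      | some none => some (obj (attachAttr a (incAt 0 u) attrs))
      | _ => none
    | t => (headRed phi t).map (fun t' => app t' a u)

mutual
/-- Normal order reduction `⇝ℓ` as a (deterministic) partial function:
head reduction first, otherwise reduce the leftmost subterm that reduces. -/
def nordRed (phi : L) : Tm L → Option (Tm L)
  | loc _ => none
  | dot t a =>
    match headRed phi (dot t a) with
    | some s => some s
    | none => (nordRed phi t).map (fun t' => dot t' a)
  | app t a u =>
    match headRed phi (app t a u) with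
    | some s => some s
    | none =>
      match nordRed phi t with
      | some t' => some (app t' a u)
      | none => (nordRed phi u).map (fun u' => app t a u')
  | obj attrs => (nordList phi attrs).map obj

def nordList (phi : L) : List (L × Option (Tm L)) → Option (List (L × Option (Tm L)))
  | [] => none
  | (a, none) :: rest => (nordList phi rest).map (fun rest' => (a, none) :: rest')
  | (a, some t) :: rest =>
    match nordRed phi t with
    | some t' => some ((a, some t') :: rest)
    | none => (nordList phi rest).map (fun rest' => (a, some t) :: rest')
end

/-- Normal order reduction relation. -/
def NOrd (phi : L) (t t' : Tm L) : Prop := nordRed phi t = some t'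

end Extra
end Tm
end PhiCalc
namespace PhiCalc
namespace Tm

section Substitution

variable {L : Type}

mutual
theorem incAt_incAt {i n : Nat} (h : i ≤ n) : ∀ t : Tm L,
    incAt i (incAt n t) = incAt (n + 1) (incAt i t)
  | loc m => by
    simp only [incAt]
    split_ifs <;> simp only [incAt] <;> split_ifs <;> first | rfl | omega
  | dot t a => by simp only [incAt, incAt_incAt h t]
  | app t a u => by simp only [incAt, incAt_incAt h t, incAt_incAt h u]
  | obj l => by simp only [incAt, incAtList_incAtList (Nat.succ_le_succ h) l]

theorem incAtList_incAtList {i n : Nat} (h : i ≤ n) : ∀ l : List (L × Option (Tm L)),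
    incAtList i (incAtList n l) = incAtList (n + 1) (incAtList i l)
  | [] => by simp only [incAtList]
  | (a, none) :: rest => by simp only [incAtList, incAtList_incAtList h rest]
  | (a, some t) :: rest => by
    simp only [incAtList, incAt_incAt h t, incAtList_incAtList h rest]
end

mutual
theorem incAt_subst_of_le {i n : Nat} (h : i ≤ n) : ∀ (t u : Tm L),
    incAt i (subst t n u) = subst (incAt i t) (n + 1) (incAt i u)
  | loc m, u => by
    simp only [incAt, subst]
    split_ifs <;> simp only [incAt, subst] <;> split_ifs <;>
      first | rfl | omega | (congr 1; omega)
  | dot t a, u => by simp only [incAt, subst, incAt_subst_of_le h t]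
  | app t a v, u => by simp only [incAt, subst, incAt_subst_of_le h t, incAt_subst_of_le h v]
  | obj l, u => by
    simp only [incAt, subst, incAtList_substList_of_le (Nat.succ_le_succ h) l,
      incAt_incAt (Nat.zero_le i) u]

theorem incAtList_substList_of_le {i n : Nat} (h : i ≤ n) :
    ∀ (l : List (L × Option (Tm L))) (u : Tm L),
    incAtList i (substList l n u) = substList (incAtList i l) (n + 1) (incAt i u)
  | [], _ => by simp only [incAtList, substList]
  | (a, none) :: rest, u => by
    simp only [incAtList, substList, incAtList_substList_of_le h rest]
  | (a, some t) :: rest, u => by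
    simp only [incAtList, substList, incAt_subst_of_le h t, incAtList_substList_of_le h rest]
end

mutual
theorem incAt_subst_of_ge {i n : Nat} (h : n ≤ i) : ∀ (t u : Tm L),
    incAt i (subst t n u) = subst (incAt (i + 1) t) n (incAt i u)
  | loc m, u => by
    simp only [incAt, subst]
    split_ifs <;> simp only [incAt, subst] <;> split_ifs <;>
      first | rfl | omega | (congr 1; omega)
  | dot t a, u => by simp only [incAt, subst, incAt_subst_of_ge h t]
  | app t a v, u => by simp only [incAt, subst, incAt_subst_of_ge h t, incAt_subst_of_ge h v]
  | obj l, u => by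
    simp only [incAt, subst, incAtList_substList_of_ge (Nat.succ_le_succ h) l,
      incAt_incAt (Nat.zero_le i) u]

theorem incAtList_substList_of_ge {i n : Nat} (h : n ≤ i) :
    ∀ (l : List (L × Option (Tm L))) (u : Tm L),
    incAtList i (substList l n u) = substList (incAtList (i + 1) l) n (incAt i u)
  | [], _ => by simp only [incAtList, substList]
  | (a, none) :: rest, u => by
    simp only [incAtList, substList, incAtList_substList_of_ge h rest]
  | (a, some t) :: rest, u => by
    simp only [incAtList, substList, incAt_subst_of_ge h t, incAtList_substList_of_ge h rest]
end

mutual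
theorem subst_incAt (i : Nat) : ∀ (t u : Tm L), subst (incAt i t) i u = t
  | loc m, u => by
    simp only [incAt]
    split_ifs <;> simp only [subst] <;> split_ifs <;> first | rfl | omega
  | dot t a, u => by simp only [incAt, subst, subst_incAt i t]
  | app t a v, u => by simp only [incAt, subst, subst_incAt i t, subst_incAt i v]
  | obj l, u => by simp only [incAt, subst, substList_incAtList (i + 1) l]

theorem substList_incAtList (i : Nat) : ∀ (l : List (L × Option (Tm L))) (u : Tm L),
    substList (incAtList i l) i u = l
  | [], _ => by simp only [incAtList, substList]
  | (a, none) :: rest, u => by simp only [incAtList, substList, substList_incAtList i rest]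
  | (a, some t) :: rest, u => by
    simp only [incAtList, substList, subst_incAt i t, substList_incAtList i rest]
end

mutual
theorem subst_subst {i n : Nat} (h : i ≤ n) : ∀ (t v u : Tm L),
    subst (subst t i v) n u = subst (subst t (n + 1) (incAt i u)) i (subst v n u)
  | loc m, v, u => by
    rcases lt_trichotomy m (n + 1) with hm | rfl | hm
    · simp only [subst, if_pos hm]
      split_ifs <;> simp only [subst] <;> split_ifs <;> first | rfl | omega
    · have h₁ : ¬ n + 1 < i := by omega
      have h₂ : n + 1 ≠ i := by omega
      simp [subst, h₁, h₂, subst_incAt]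
    · have h₁ : ¬ m < i := by omega
      have h₂ : m ≠ i := by omega
      have h₃ : ¬ m < n + 1 := by omega
      have h₄ : m ≠ n + 1 := by omega
      simp only [subst, if_neg h₁, if_neg h₂, if_neg h₃, if_neg h₄]
      split_ifs <;> first | rfl | omega
  | dot t a, v, u => by simp only [subst, subst_subst h t]
  | app t a w, v, u => by simp only [subst, subst_subst h t, subst_subst h w]
  | obj l, v, u => by
    simp only [subst, substList_substList (Nat.succ_le_succ h) l,
      incAt_incAt (Nat.zero_le i) u, incAt_subst_of_le (Nat.zero_le n) v]

theorem substList_substList {i n : Nat} (h : i ≤ n) :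
    ∀ (l : List (L × Option (Tm L))) (v u : Tm L),
    substList (substList l i v) n u =
      substList (substList l (n + 1) (incAt i u)) i (subst v n u)
  | [], _, _ => by simp only [substList]
  | (a, none) :: rest, v, u => by simp only [substList, substList_substList h rest]
  | (a, some t) :: rest, v, u => by
    simp only [substList, subst_subst h t, substList_substList h rest]
end

end Substitution

section Attributes

variable {L : Type} [DecidableEq L]

theorem lookupAttr_incAtList (c : L) (n : Nat) : ∀ l : List (L × Option (Tm L)),
    lookupAttr c (incAtList n l) = (lookupAttr c l).map (Option.map (incAt n))
  | [] => by simp [incAtList, lookupAttr]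
  | (a, none) :: rest => by
    simp only [incAtList, lookupAttr]
    split_ifs <;> simp [lookupAttr_incAtList c n rest]
  | (a, some t) :: rest => by
    simp only [incAtList, lookupAttr]
    split_ifs <;> simp [lookupAttr_incAtList c n rest]

theorem lookupAttr_substList (c : L) (n : Nat) (u : Tm L) : ∀ l : List (L × Option (Tm L)),
    lookupAttr c (substList l n u) =
      (lookupAttr c l).map (Option.map fun t => subst t n u)
  | [] => by simp [substList, lookupAttr]
  | (a, none) :: rest => by
    simp only [substList, lookupAttr]
    split_ifs <;> simp [lookupAttr_substList c n u rest]
  | (a, some t) :: rest => by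
    simp only [substList, lookupAttr]
    split_ifs <;> simp [lookupAttr_substList c n u rest]

theorem incAtList_attachAttr (c : L) (n : Nat) (v : Tm L) : ∀ l : List (L × Option (Tm L)),
    incAtList n (attachAttr c v l) = attachAttr c (incAt n v) (incAtList n l)
  | [] => by simp [incAtList, attachAttr]
  | (a, none) :: rest => by
    simp only [incAtList, attachAttr]
    split_ifs <;> simp [incAtList, incAtList_attachAttr c n v rest]
  | (a, some t) :: rest => by
    simp only [incAtList, attachAttr]
    split_ifs <;> simp [incAtList, incAtList_attachAttr c n v rest]

theorem substList_attachAttr (c : L) (n : Nat) (u v : Tm L) :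
    ∀ l : List (L × Option (Tm L)),
    substList (attachAttr c v l) n u = attachAttr c (subst v n u) (substList l n u)
  | [] => by simp [substList, attachAttr]
  | (a, none) :: rest => by
    simp only [substList, attachAttr]
    split_ifs <;> simp [substList, substList_attachAttr c n u v rest]
  | (a, some t) :: rest => by
    simp only [substList, attachAttr]
    split_ifs <;> simp [substList, substList_attachAttr c n u v rest]

end Attributes

section ParallelReduction

variable {L : Type} [DecidableEq L] {phi : L}

theorem ParAttrs.lookupAttr_eq_none {l l' : List (L × Option (Tm L))} {c : L} :
    ParAttrs phi l l' → lookupAttr c l = none → lookupAttr c l' = none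
  | .nil, h => h
  | .void a hl, h => by
    simp only [lookupAttr] at h ⊢
    split_ifs at h ⊢
    exact hl.lookupAttr_eq_none h
  | .attached a _ hl, h => by
    simp only [lookupAttr] at h ⊢
    split_ifs at h ⊢
    exact hl.lookupAttr_eq_none h

theorem ParAttrs.lookupAttr_eq_void {l l' : List (L × Option (Tm L))} {c : L} :
    ParAttrs phi l l' → lookupAttr c l = some none → lookupAttr c l' = some none
  | .nil, h => h
  | .void a hl, h => by
    simp only [lookupAttr] at h ⊢
    split_ifs at h ⊢ with hc
    · rfl
    · exact hl.lookupAttr_eq_void h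
  | .attached a _ hl, h => by
    simp only [lookupAttr] at h ⊢
    split_ifs at h ⊢
    · simp at h
    · exact hl.lookupAttr_eq_void h

theorem ParAttrs.lookupAttr_eq_attached {l l' : List (L × Option (Tm L))} {c : L} {t : Tm L} :
    ParAttrs phi l l' → lookupAttr c l = some (some t) →
      ∃ t', lookupAttr c l' = some (some t') ∧ Par phi t t'
  | .nil, h => by simp [lookupAttr] at h
  | .void a hl, h => by
    simp only [lookupAttr] at h ⊢
    split_ifs at h ⊢
    · simp at h
    · exact hl.lookupAttr_eq_attached h
  | .attached a ht hl, h => by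
    simp only [lookupAttr] at h ⊢
    split_ifs at h ⊢
    · simp only [Option.some.injEq] at h
      exact ⟨_, rfl, h ▸ ht⟩
    · exact hl.lookupAttr_eq_attached h

theorem ParAttrs.lookupAttr_isSome {l l' : List (L × Option (Tm L))} {c : L}
    (hl : ParAttrs phi l l') (h : (lookupAttr c l).isSome) : (lookupAttr c l').isSome := by
  rcases hc : lookupAttr c l with _ | _ | t
  · simp [hc] at h
  · simp [hl.lookupAttr_eq_void hc]
  · obtain ⟨t', ht', -⟩ := hl.lookupAttr_eq_attached hc
    simp [ht']

theorem ParAttrs.attachAttr {l l' : List (L × Option (Tm L))} {c : L} {u u' : Tm L}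
    (hu : Par phi u u') :
    ParAttrs phi l l' → ParAttrs phi (attachAttr c u l) (attachAttr c u' l')
  | .nil => .nil
  | .void a hl => by
    simp only [Tm.attachAttr]
    split_ifs
    · exact .attached a hu hl
    · exact .void a (hl.attachAttr hu)
  | .attached a ht hl => by
    simp only [Tm.attachAttr]
    split_ifs
    · exact .attached a hu hl
    · exact .attached a ht (hl.attachAttr hu)

mutual
theorem Par.refl : ∀ t : Tm L, Par phi t t
  | Tm.loc n => .loc n
  | dot t a => .congDot a (Par.refl t)
  | app t a u => .congApp a (Par.refl t) (Par.refl u)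
  | Tm.obj l => .obj (ParAttrs.refl l)

theorem ParAttrs.refl : ∀ l : List (L × Option (Tm L)), ParAttrs phi l l
  | [] => .nil
  | (a, none) :: rest => .void a (ParAttrs.refl rest)
  | (a, some t) :: rest => .attached a (Par.refl t) (ParAttrs.refl rest)
end

mutual
theorem Par.incAt {t t' : Tm L} : Par phi t t' → ∀ n : Nat,
    Par phi (incAt n t) (incAt n t')
  | .loc m, n => Par.refl _
  | .obj hl, n => by
    simp only [Tm.incAt]
    exact .obj (hl.incAtList _)
  | .congDot a ht, n => by
    simp only [Tm.incAt]
    exact .congDot a (ht.incAt n)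
  | .congApp a ht hu, n => by
    simp only [Tm.incAt]
    exact .congApp a (ht.incAt n) (hu.incAt n)
  | .dotPar (attrs := l) ht hc, n => by
    rw [incAt_subst_of_ge (Nat.zero_le n)]
    simp only [Tm.incAt]
    have h := ht.incAt n
    simp only [Tm.incAt] at h
    exact .dotPar h (by simp [lookupAttr_incAtList, hc])
  | .dotPhi ht hc hphi, n => by
    have h := ht.incAt n
    simp only [Tm.incAt] at h ⊢
    exact .dotPhi h (by simp [lookupAttr_incAtList, hc])
      (by simpa [lookupAttr_incAtList] using hphi)
  | .appPar ht hc hu, n => by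
    have h := ht.incAt n
    simp only [Tm.incAt, incAtList_attachAttr, ← incAt_incAt (Nat.zero_le n)] at h ⊢
    exact .appPar h (by simp [lookupAttr_incAtList, hc]) (hu.incAt n)

theorem ParAttrs.incAtList {l l' : List (L × Option (Tm L))} :
    ParAttrs phi l l' → ∀ n : Nat, ParAttrs phi (incAtList n l) (incAtList n l')
  | .nil, n => .nil
  | .void a hl, n => by
    simp only [Tm.incAtList]
    exact .void a (hl.incAtList n)
  | .attached a ht hl, n => by
    simp only [Tm.incAtList]
    exact .attached a (ht.incAt n) (hl.incAtList n)
end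

mutual
theorem Par.subst {t t' : Tm L} : Par phi t t' → ∀ {n : Nat} {u u' : Tm L}, Par phi u u' →
    Par phi (subst t n u) (subst t' n u')
  | .loc m, n, u, u', hu => by
    simp only [Tm.subst]
    split_ifs
    · exact .loc _
    · exact hu
    · exact .loc _
  | .obj hl, n, u, u', hu => by
    simp only [Tm.subst]
    exact .obj (hl.substList (hu.incAt 0))
  | .congDot a ht, n, u, u', hu => by
    simp only [Tm.subst]
    exact .congDot a (ht.subst hu)
  | .congApp a ht hv, n, u, u', hu => by
    simp only [Tm.subst]
    exact .congApp a (ht.subst hu) (hv.subst hu)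
  | .dotPar ht hc, n, u, u', hu => by
    rw [subst_subst (Nat.zero_le n)]
    have h := ht.subst (n := n) hu
    simp only [Tm.subst] at h ⊢
    exact .dotPar h (by simp [lookupAttr_substList, hc])
  | .dotPhi ht hc hphi, n, u, u', hu => by
    have h := ht.subst (n := n) hu
    simp only [Tm.subst] at h ⊢
    exact .dotPhi h (by simp [lookupAttr_substList, hc])
      (by simpa [lookupAttr_substList] using hphi)
  | .appPar ht hc hv, n, u, u', hu => by
    have h := ht.subst (n := n) hu
    simp only [Tm.subst, substList_attachAttr, ← incAt_subst_of_le (Nat.zero_le n)] at h ⊢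
    exact .appPar h (by simp [lookupAttr_substList, hc]) (hv.subst hu)

theorem ParAttrs.substList {l l' : List (L × Option (Tm L))} :
    ParAttrs phi l l' → ∀ {n : Nat} {u u' : Tm L}, Par phi u u' →
      ParAttrs phi (substList l n u) (substList l' n u')
  | .nil, n, u, u', hu => .nil
  | .void a hl, n, u, u', hu => by
    simp only [Tm.substList]
    exact .void a (hl.substList hu)
  | .attached a ht hl, n, u, u', hu => by
    simp only [Tm.substList]
    exact .attached a (ht.subst hu) (hl.substList hu)
end

theorem Par.exists_of_obj {l : List (L × Option (Tm L))} {t : Tm L}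
    (h : Par phi (Tm.obj l) t) : ∃ l', t = Tm.obj l' ∧ ParAttrs phi l l' := by
  cases h with
  | obj hl => exact ⟨_, rfl, hl⟩

mutual
/-- Any parallel reduct of `t` reduces in parallel to the complete development of `t`. -/
theorem Par.cd {t t' : Tm L} : Par phi t t' → Par phi t' (cd phi t)
  | .loc n => by
    simp only [Tm.cd]
    exact .loc n
  | .obj hl => by
    simp only [Tm.cd]
    exact .obj hl.cdList
  | .congDot a ht => by
    have h := ht.cd
    simp only [Tm.cd]
    split
    · next l hl =>
      rw [hl] at h
      split
      · next hc => exact .dotPar h hc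
      · exact .congDot a h
      · next hc =>
        split_ifs with hphi
        · exact .dotPhi h hc hphi
        · exact .congDot a h
    · exact .congDot a h
  | .congApp a ht hu => by
    have h := ht.cd
    simp only [Tm.cd]
    split
    · next l hl =>
      rw [hl] at h
      split
      · next hc => exact .appPar h hc hu.cd
      · exact .congApp a h hu.cd
    · exact .congApp a h hu.cd
  | .dotPar ht hc => by
    obtain ⟨l, hcd, hl⟩ := ht.cd.exists_of_obj
    obtain ⟨s, hs, hpar⟩ := hl.lookupAttr_eq_attached hc
    simp only [Tm.cd, hcd, hs]
    exact hpar.subst (.obj hl)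
  | .dotPhi ht hc hphi => by
    obtain ⟨l, hcd, hl⟩ := ht.cd.exists_of_obj
    simp only [Tm.cd, hcd, hl.lookupAttr_eq_none hc, hl.lookupAttr_isSome hphi, if_true]
    exact .congDot _ (.congDot _ (.obj hl))
  | .appPar ht hc hu => by
    obtain ⟨l, hcd, hl⟩ := ht.cd.exists_of_obj
    simp only [Tm.cd, hcd, hl.lookupAttr_eq_void hc]
    exact .obj (hl.attachAttr (hu.cd.incAt 0))

theorem ParAttrs.cdList {l l' : List (L × Option (Tm L))} :
    ParAttrs phi l l' → ParAttrs phi l' (cdList phi l)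
  | .nil => .nil
  | .void a hl => by
    simp only [Tm.cdList]
    exact .void a hl.cdList
  | .attached a ht hl => by
    simp only [Tm.cdList]
    exact .attached a ht.cd hl.cdList
end

theorem ParAttrs.append_left {l l' : List (L × Option (Tm L))} (h : ParAttrs phi l l') :
    ∀ pre : List (L × Option (Tm L)), ParAttrs phi (pre ++ l) (pre ++ l')
  | [] => h
  | (a, none) :: rest => .void a (h.append_left rest)
  | (a, some t) :: rest => .attached a (Par.refl t) (h.append_left rest)

theorem Step.par {t t' : Tm L} (h : Step phi t t') : Par phi t t' := by
  induction h with
  | congObj pre post b _ ih => exact .obj ((ParAttrs.attached b ih (.refl post)).append_left pre)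
  | congDot a _ ih => exact .congDot a ih
  | congAppL a _ ih => exact .congApp a ih (.refl _)
  | congAppR a _ ih => exact .congApp a (.refl _) ih
  | dotStep hc => exact .dotPar (.refl _) hc
  | dotPhi hc hphi => exact .dotPhi (.refl _) hc hphi
  | appStep hc => exact .appPar (.refl _) hc (.refl _)

open Relation

theorem reflTransGen_step_dot {t t' : Tm L} (a : L) (h : ReflTransGen (Step phi) t t') :
    ReflTransGen (Step phi) (dot t a) (dot t' a) :=
  h.lift (fun t => dot t a) fun _ _ => Step.congDot a

theorem reflTransGen_step_app {t t' u u' : Tm L} (a : L)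
    (ht : ReflTransGen (Step phi) t t') (hu : ReflTransGen (Step phi) u u') :
    ReflTransGen (Step phi) (app t a u) (app t' a u') :=
  (ht.lift (fun t => app t a u) fun _ _ => Step.congAppL a).trans
    (hu.lift (fun u => app t' a u) fun _ _ => Step.congAppR a)

mutual
theorem Par.reflTransGen_step {t t' : Tm L} : Par phi t t' → ReflTransGen (Step phi) t t'
  | .loc _ => .refl
  | .obj hl => hl.reflTransGen_step []
  | .congDot a ht => reflTransGen_step_dot a ht.reflTransGen_step
  | .congApp a ht hu => reflTransGen_step_app a ht.reflTransGen_step hu.reflTransGen_step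
  | .dotPar ht hc => (reflTransGen_step_dot _ ht.reflTransGen_step).tail (.dotStep hc)
  | .dotPhi ht hc hphi =>
    (reflTransGen_step_dot _ ht.reflTransGen_step).tail (.dotPhi hc hphi)
  | .appPar ht hc hu =>
    (reflTransGen_step_app _ ht.reflTransGen_step hu.reflTransGen_step).tail (.appStep hc)

theorem ParAttrs.reflTransGen_step {l l' : List (L × Option (Tm L))} :
    ParAttrs phi l l' → ∀ pre : List (L × Option (Tm L)),
      ReflTransGen (Step phi) (Tm.obj (pre ++ l)) (Tm.obj (pre ++ l'))
  | .nil, _ => .refl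
  | .void a hl, pre => by
    have h := hl.reflTransGen_step (pre ++ [(a, none)])
    simp only [List.append_assoc, List.singleton_append] at h
    exact h
  | .attached (t' := t') (rest := rest) a ht hl, pre => by
    have h := hl.reflTransGen_step (pre ++ [(a, some t')])
    simp only [List.append_assoc, List.singleton_append] at h
    exact (ht.reflTransGen_step.lift (fun s => Tm.obj (pre ++ (a, some s) :: rest))
      fun _ _ => Step.congObj pre rest a).trans h
end

theorem reflTransGen_par_iff {t t' : Tm L} :
    ReflTransGen (Par phi) t t' ↔ ReflTransGen (Step phi) t t' := by
  refine ⟨fun h => ?_, fun h => h.lift id fun _ _ => Step.par⟩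
  induction h with
  | refl => exact .refl
  | tail _ hs ih => exact ih.trans hs.reflTransGen_step

end ParallelReduction

end Tm
end PhiCalc

open PhiCalc Tm in
/-- Confluence (Church-Rosser property) of the φ-calculus. -/
theorem confluence {L : Type} [DecidableEq L] (phi : L) {t u v : Tm L}
    (htu : Relation.ReflTransGen (Step phi) t u)
    (htv : Relation.ReflTransGen (Step phi) t v) :
    ∃ w : Tm L, Relation.ReflTransGen (Step phi) u w ∧
      Relation.ReflTransGen (Step phi) v w := by
  obtain ⟨w, hu, hv⟩ := Relation.church_rosser
    (fun a b c (hb : Par phi a b) (hc : Par phi a c) =>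
      ⟨cd phi a, .single hb.cd, .single hc.cd⟩)
    (reflTransGen_par_iff.2 htu) (reflTransGen_par_iff.2 htv)
  exact ⟨w, reflTransGen_par_iff.1 hu, reflTransGen_par_iff.1 hv⟩
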